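/- arXiv:2404.04024 — 3 statements merged into one kernel-verified Lean document; each statement's English description precedes it below -/
import Mathlib

section
/- Let G = (V,E) be a DAG, Ω = diag(ω_i) with all ω_i > 0, Λ ∈ ℝ^E, and Σ = φ_G(Ω,Λ). Then for every edge ij ∈ E, λ_{ij} · |Σ_{pa_G(j)}| = |Σ_{ij|pa_G(j)∖{i}}|; equivalently, λ_{ij} = λ_{ij|pa_G(j)}(Σ). -/
open Matrix

/-- Principal minor `|Σ_A|`: determinant of the submatrix with rows and columns `A`. -/
noncomputable def pminor {p : ℕ} {R : Type*} [CommRing R] (M : Matrix (Fin p) (Fin p) R)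
    (A : Finset (Fin p)) : R :=
  (M.submatrix (fun a : {x // x ∈ A} => a.1) (fun a : {x // x ∈ A} => a.1)).det

/-- Almost-principal minor `|Σ_{ij|K}| = |Σ_{{i}∪K, {j}∪K}|`: determinant of the submatrix
with rows `{i} ∪ K` and columns `{j} ∪ K`, where `i` is matched with `j` and the elements
of `K` are matched with themselves. -/
noncomputable def cminor {p : ℕ} {R : Type*} [CommRing R] (M : Matrix (Fin p) (Fin p) R)
    (i j : Fin p) (K : Finset (Fin p)) : R :=
  (M.submatrix (Sum.elim (fun _ : Unit => i) (fun k : {x // x ∈ K} => k.1))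
               (Sum.elim (fun _ : Unit => j) (fun k : {x // x ∈ K} => k.1))).det

/-- The parametrization `φ_G(Ω,Λ) = (1-Λ)^{-T} Ω (1-Λ)⁻¹` of a Gaussian DAG model. -/
noncomputable def phiG {p : ℕ} (W L : Matrix (Fin p) (Fin p) ℝ) : Matrix (Fin p) (Fin p) ℝ :=
  ((1 - L)⁻¹)ᵀ * W * (1 - L)⁻¹

/-- The parents `pa_G(j) = {k : (k,j) ∈ E}` of a vertex `j` in the DAG with edge set `E`. -/
def parents {p : ℕ} (E : Finset (Fin p × Fin p)) (j : Fin p) : Finset (Fin p) :=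
  Finset.univ.filter (fun k => (k, j) ∈ E)

/-- A directed graph with edge set `E` is acyclic iff no vertex lies on a directed cycle. -/
def IsAcyclic {p : ℕ} (E : Finset (Fin p × Fin p)) : Prop :=
  ∀ i : Fin p, ¬ Relation.TransGen (fun a b => (a, b) ∈ E) i i

/-- `j` lies in `de̅_G(i) = {i} ∪ de_G(i)`, the closure of the descendants of `i`. -/
def InDescClosure {p : ℕ} (E : Finset (Fin p × Fin p)) (i j : Fin p) : Prop :=
  j = i ∨ Relation.TransGen (fun a b => (a, b) ∈ E) i j

/-- The number of ancestors of a vertex strictly increases along the edges of a DAG. -/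
lemma IsAcyclic.exists_strictMono_rank {p : ℕ} {E : Finset (Fin p × Fin p)} (hE : IsAcyclic E) :
    ∃ r : Fin p → ℕ, ∀ a b, (a, b) ∈ E → r a < r b := by
  classical
  refine ⟨fun b => (Finset.univ.filter
    fun a => Relation.TransGen (fun x y => (x, y) ∈ E) a b).card, fun a b hab => ?_⟩
  refine Finset.card_lt_card (Finset.ssubset_iff_of_subset ?_ |>.mpr ⟨a, ?_, ?_⟩)
  · intro c hc
    simp only [Finset.mem_filter, Finset.mem_univ, true_and] at hc ⊢
    exact hc.tail hab
  · simpa using Relation.TransGen.single hab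
  · simpa using hE a

/-- If `L` strictly increases a rank function, then `1 - L` is unimodular. -/
lemma det_one_sub_of_rank {n : Type*} [Fintype n] [DecidableEq n] {R : Type*} [CommRing R]
    {L : Matrix n n R} {r : n → ℕ} (hr : ∀ a b, r b ≤ r a → L a b = 0) :
    (1 - L).det = 1 := by
  have hT : (1 - L).BlockTriangular r :=
    blockTriangular_one.sub fun a b h => hr a b h.le
  rw [hT.det]
  refine Finset.prod_eq_one fun k _ => ?_
  have : (1 - L).toSquareBlock r k = 1 := by
    ext a b
    have h0 : L a.1 b.1 = 0 := hr _ _ (b.2.trans a.2.symm).le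
    simp [toSquareBlock_def, h0, one_apply, Subtype.ext_iff]
  rw [this, det_one]

/-- If `L` strictly increases a rank function, then `(1 - L)⁻¹` weakly increases it. -/
lemma inv_one_sub_apply_eq_zero_of_rank {n : Type*} [Fintype n] [DecidableEq n] {R : Type*}
    [CommRing R] {L : Matrix n n R} {r : n → ℕ} (hr : ∀ a b, r b ≤ r a → L a b = 0)
    {a b : n} (hab : r b < r a) : (1 - L)⁻¹ a b = 0 := by
  have hT : (1 - L).BlockTriangular r :=
    blockTriangular_one.sub fun a b h => hr a b h.le
  have hu : IsUnit (1 - L).det := by rw [det_one_sub_of_rank hr]; exact isUnit_one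
  have := invertibleOfIsUnitDet _ hu
  exact blockTriangular_inv_of_blockTriangular hT hab

lemma phiG_posDef {p : ℕ} {ω : Fin p → ℝ} (hω : ∀ v, 0 < ω v) {L : Matrix (Fin p) (Fin p) ℝ}
    (hL : IsUnit (1 - L).det) : (phiG (diagonal ω) L).PosDef := by
  have hinj : Function.Injective ((1 - L)⁻¹).mulVec :=
    mulVec_injective_iff_isUnit.mpr
      ((isUnit_iff_isUnit_det _).mpr (isUnit_nonsing_inv_det _ hL))
  simpa [phiG, conjTranspose_eq_transpose_of_trivial] using
    (posDef_diagonal_iff.mpr hω).conjTranspose_mul_mul_same hinj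

lemma phiG_mul_one_sub {p : ℕ} (W : Matrix (Fin p) (Fin p) ℝ) {L : Matrix (Fin p) (Fin p) ℝ}
    (hL : IsUnit (1 - L).det) : phiG W L * (1 - L) = ((1 - L)⁻¹)ᵀ * W := by
  rw [phiG, Matrix.mul_assoc, nonsing_inv_mul _ hL, Matrix.mul_one]

/-- A principal minor computed with a distinguished index `i ∈ A` listed first. -/
lemma cminor_self_erase {p : ℕ} {R : Type*} [CommRing R] (M : Matrix (Fin p) (Fin p) R)
    {i : Fin p} {A : Finset (Fin p)} (hi : i ∈ A) : cminor M i i (A.erase i) = pminor M A := by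
  let f : Unit ⊕ {x // x ∈ A.erase i} → {x // x ∈ A} :=
    Sum.elim (fun _ => ⟨i, hi⟩) fun k => ⟨k.1, Finset.mem_of_mem_erase k.2⟩
  have hf : Function.Bijective f := by
    constructor
    · rintro (_ | ⟨a, ha⟩) (_ | ⟨b, hb⟩) h <;> simp [f] at h ⊢
      · exact Finset.ne_of_mem_erase hb h.symm
      · exact Finset.ne_of_mem_erase ha h
      · exact h
    · rintro ⟨a, ha⟩
      by_cases h : a = i
      · exact ⟨Sum.inl (), by simp [f, h]⟩
      · exact ⟨Sum.inr ⟨a, Finset.mem_erase.mpr ⟨h, ha⟩⟩, rfl⟩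
  rw [cminor, pminor, ← det_submatrix_equiv_self (Equiv.ofBijective f hf), submatrix_submatrix]
  congr 2 <;> (funext x; rcases x with _ | _ <;> rfl)

/-- Cramer's rule: if column `j` of `M` is, on the rows in `A`, a combination with coefficients
`c` of the columns in `A`, then `c i` scales `|M_A|` to `|M_{ij|A∖i}|`. -/
lemma mul_pminor_eq_cminor {p : ℕ} {R : Type*} [CommRing R] (M : Matrix (Fin p) (Fin p) R)
    {i j : Fin p} {A : Finset (Fin p)} (hi : i ∈ A) (c : Fin p → R)
    (hc : ∀ a ∈ A, M a j = ∑ k ∈ A, M a k * c k) :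
    c i * pminor M A = cminor M i j (A.erase i) := by
  rw [← cminor_self_erase M hi]
  let e : Unit ⊕ {x // x ∈ A.erase i} → Fin p := Sum.elim (fun _ => i) fun k => k.1
  have hmem : ∀ x, e x ∈ A := by
    rintro (_ | k)
    · exact hi
    · exact Finset.mem_of_mem_erase k.2
  have hcol : M.submatrix e (Sum.elim (fun _ : Unit => j) fun k : {x // x ∈ A.erase i} => k.1) =
      (M.submatrix e e).updateCol (Sum.inl ()) (M.submatrix e e *ᵥ (c ∘ e)) := by
    ext x y
    rcases y with _ | y
    · rw [updateCol_self, submatrix_apply, Sum.elim_inl, hc _ (hmem x), mulVec, dotProduct,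
        Fintype.sum_sum_type, ← Finset.add_sum_erase _ _ hi, ← Finset.sum_coe_sort]
      simp [e]
    · simp [e]
  have hcramer : (M.submatrix e e).cramer (M.submatrix e e *ᵥ (c ∘ e)) =
      (M.submatrix e e).det • (c ∘ e) := by
    rw [cramer_eq_adjugate_mulVec, mulVec_mulVec, adjugate_mul, smul_mulVec, one_mulVec]
  rw [cminor, cminor, hcol, ← cramer_apply, hcramer]
  simp [e, mul_comm]

/-- Lemma on recovering structural coefficients.
Let `G = (V,E)` be a DAG, `Ω = diag(ω)` with positive diagonal, `Λ ∈ ℝ^E`, and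
`Σ = φ_G(Ω,Λ)`.  Then for every edge `ij ∈ E`,
`λ_{ij} · |Σ_{pa(j)}| = |Σ_{ij | pa(j) ∖ {i}}|`; equivalently `λ_{ij} = λ_{ij|pa(j)}(Σ)`. -/
theorem lambda_recovery {p : ℕ} (E : Finset (Fin p × Fin p)) (hE : IsAcyclic E)
    (ω : Fin p → ℝ) (hω : ∀ v, 0 < ω v)
    (L : Matrix (Fin p) (Fin p) ℝ) (hL : ∀ a b, (a, b) ∉ E → L a b = 0)
    (S : Matrix (Fin p) (Fin p) ℝ) (hS : S = phiG (Matrix.diagonal ω) L)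
    (i j : Fin p) (hij : (i, j) ∈ E) :
    L i j * pminor S (parents E j) = cminor S i j ((parents E j).erase i) ∧
    L i j = cminor S i j ((parents E j).erase i) / pminor S (parents E j) := by
  obtain ⟨r, hr⟩ := hE.exists_strictMono_rank
  have hrL : ∀ a b, r b ≤ r a → L a b = 0 := fun a b h =>
    hL a b fun hab => (hr a b hab).not_ge h
  have hu : IsUnit (1 - L).det := by rw [det_one_sub_of_rank hrL]; exact isUnit_one
  have hpos : pminor S (parents E j) ≠ 0 := by
    rw [hS]
    exact ((phiG_posDef hω hu).submatrix Subtype.val_injective).det_pos.ne'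
  have hmul : L i j * pminor S (parents E j) = cminor S i j ((parents E j).erase i) := by
    refine mul_pminor_eq_cminor S (by simpa [parents] using hij) (fun k => L k j) fun a ha => ?_
    have haj : (a, j) ∈ E := by simpa [parents] using ha
    have h := congrFun₂ (phiG_mul_one_sub (diagonal ω) hu) a j
    rw [← hS, mul_diagonal, transpose_apply,
      inv_one_sub_apply_eq_zero_of_rank hrL (hr a j haj), zero_mul, Matrix.mul_sub,
      Matrix.mul_one, Matrix.sub_apply, sub_eq_zero, mul_apply] at h
    rw [h]
    refine (Finset.sum_subset (Finset.subset_univ _) fun k _ hk => ?_).symm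
    rw [hL k j (by simpa [parents] using hk), mul_zero]
  exact ⟨hmul, (eq_div_iff hpos).mpr hmul⟩
end

section
/- Let G = (V,E) be a DAG, i ∈ V a vertex and A ⊆ V. Then ω_{i|A}(φ_G(Ω,Λ)) = ω_i holds for every choice of Ω = diag(ω_k) with all ω_k > 0 and every Λ ∈ ℝ^E if and only if pa_G(i) ⊆ A and A ∩ de̅_G(i) = ∅ (i.e., pa_G(i) ⊆ A ⊆ V ∖ de̅_G(i)). -/
open Matrix

/-- If `x` is supported on `{i} ∪ A`, has `x i = 1`, and `M x` vanishes on `A`, then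
`|M_{A ∪ {i}}| = (M x)_i |M_A|`. -/
theorem pminor_insert_of_mulVec {p : ℕ} {R : Type*} [CommRing R] (M : Matrix (Fin p) (Fin p) R)
    {i : Fin p} {A : Finset (Fin p)} (hi : i ∉ A) (x : Fin p → R) (hxi : x i = 1)
    (hsupp : ∀ k ∉ insert i A, x k = 0) (hx : ∀ j ∈ A, (M *ᵥ x) j = 0) :
    pminor M (insert i A) = (M *ᵥ x) i * pminor M A := by
  classical
  have hMx : ∀ j, (M *ᵥ x) j = M j i + ∑ a : {a // a ∈ A}, M j a.1 * x a.1 := by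
    intro j
    rw [Matrix.mulVec, dotProduct,
      ← Finset.sum_subset (Finset.subset_univ (insert i A))
        (fun k _ hk => by rw [hsupp k hk, mul_zero]),
      Finset.sum_insert hi, hxi, mul_one, ← Finset.sum_coe_sort A (fun a => M j a * x a)]
  let f : Unit ⊕ {a // a ∈ A} → {a // a ∈ insert i A} :=
    Sum.elim (fun _ => ⟨i, Finset.mem_insert_self i A⟩)
      (fun a => ⟨a.1, Finset.mem_insert_of_mem a.2⟩)
  have hf : Function.Bijective f := by
    constructor
    · rintro (⟨⟩ | ⟨a, ha⟩) (⟨⟩ | ⟨b, hb⟩) hab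
      · rfl
      · have h : i = b := congrArg Subtype.val hab
        exact absurd (h ▸ hb) hi
      · have h : a = i := congrArg Subtype.val hab
        exact absurd (h ▸ ha) hi
      · simpa [f] using hab
    · rintro ⟨a, ha⟩
      rcases Finset.mem_insert.1 ha with rfl | h
      · exact ⟨Sum.inl (), rfl⟩
      · exact ⟨Sum.inr ⟨a, h⟩, rfl⟩
  let MA : Matrix {a // a ∈ A} {a // a ∈ A} R := M.submatrix (fun a => a.1) (fun a => a.1)
  let r : Matrix Unit {a // a ∈ A} R := Matrix.of fun _ a => M i a.1
  let c : Matrix {a // a ∈ A} Unit R := Matrix.of fun a _ => M a.1 i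
  let d : Matrix Unit Unit R := Matrix.of fun _ _ => M i i
  let xA : Matrix {a // a ∈ A} Unit R := Matrix.of fun a _ => x a.1
  have h1 : pminor M (insert i A) = (Matrix.fromBlocks d r c MA).det := by
    rw [pminor, ← Matrix.det_submatrix_equiv_self (Equiv.ofBijective f hf)]
    congr 1
    ext (⟨⟩ | a) (⟨⟩ | b) <;> rfl
  have h2 : Matrix.fromBlocks d r c MA * Matrix.fromBlocks 1 0 xA 1 =
      Matrix.fromBlocks (Matrix.of fun _ _ => (M *ᵥ x) i) r 0 MA := by
    rw [Matrix.fromBlocks_multiply]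
    congr 1
    · ext
      simp [d, r, xA, hMx, Matrix.mul_apply]
    · simp
    · ext a
      have := hx a.1 a.2
      rw [hMx] at this
      simpa [c, MA, xA, Matrix.mul_apply] using this
    · simp
  have h3 := congrArg Matrix.det h2
  rw [Matrix.det_mul, Matrix.det_fromBlocks_zero₁₂, Matrix.det_fromBlocks_zero₂₁] at h3
  rw [h1]
  simpa [pminor, MA] using h3

theorem pminor_pos {p : ℕ} {M : Matrix (Fin p) (Fin p) ℝ} (hM : M.PosDef)
    (A : Finset (Fin p)) : 0 < pminor M A :=
  (hM.submatrix (e := fun a : {x // x ∈ A} => a.1) Subtype.val_injective).det_pos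

/-- The conditional variance of `i` given `A` is at most the variance of any `X_i + ∑_{A} v_a X_a`. -/
theorem pminor_insert_le {p : ℕ} {M : Matrix (Fin p) (Fin p) ℝ} (hM : M.PosDef)
    {i : Fin p} {A : Finset (Fin p)} (hi : i ∉ A) (v : Fin p → ℝ) (hvi : v i = 1)
    (hsupp : ∀ k ∉ insert i A, v k = 0) :
    pminor M (insert i A) ≤ (v ⬝ᵥ M *ᵥ v) * pminor M A := by
  classical
  let MA : Matrix {a // a ∈ A} {a // a ∈ A} ℝ := M.submatrix (fun a => a.1) (fun a => a.1)
  have hdet : IsUnit MA.det := (pminor_pos hM A).ne'.isUnit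
  let z : {a // a ∈ A} → ℝ := MA⁻¹ *ᵥ (fun a => -M a.1 i)
  have hz : MA *ᵥ z = fun a => -M a.1 i := by
    simp only [z, Matrix.mulVec_mulVec, Matrix.mul_nonsing_inv _ hdet, Matrix.one_mulVec]
  let x : Fin p → ℝ := fun k => if h : k ∈ A then z ⟨k, h⟩ else if k = i then 1 else 0
  have hxi : x i = 1 := by simp [x, hi]
  have hxs : ∀ k ∉ insert i A, x k = 0 := by
    intro k hk
    simp only [Finset.mem_insert, not_or] at hk
    simp [x, hk.1, hk.2]
  have hx : ∀ j ∈ A, (M *ᵥ x) j = 0 := by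
    intro j hj
    have h := congrFun hz ⟨j, hj⟩
    rw [Matrix.mulVec, dotProduct,
      ← Finset.sum_subset (Finset.subset_univ (insert i A))
        (fun k _ hk => by rw [hxs k hk, mul_zero]),
      Finset.sum_insert hi, hxi, mul_one, ← Finset.sum_coe_sort A (fun a => M j a * x a)]
    have h' : ∑ a : {a // a ∈ A}, M j a.1 * x a.1 = -M j i := by
      rw [← h]
      simp [Matrix.mulVec, dotProduct, MA, x]
    rw [h', add_neg_cancel]
  have hdot : ∀ w : Fin p → ℝ, w i = 1 → (∀ k ∉ insert i A, w k = 0) →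
      w ⬝ᵥ M *ᵥ x = (M *ᵥ x) i := by
    intro w hwi hws
    rw [dotProduct, Finset.sum_eq_single i, hwi, one_mul]
    · intro b _ hb
      by_cases hbA : b ∈ A
      · rw [hx b hbA, mul_zero]
      · rw [hws b (by simp [hb, hbA]), zero_mul]
    · simp
  have hsymm : x ⬝ᵥ M *ᵥ v = v ⬝ᵥ M *ᵥ x := by
    have hT : Mᵀ = M := by simpa [Matrix.IsSymm] using hM.isHermitian
    rw [Matrix.dotProduct_mulVec, ← Matrix.mulVec_transpose, hT, dotProduct_comm]
  have hnn : 0 ≤ (v - x) ⬝ᵥ M *ᵥ (v - x) := by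
    simpa using hM.posSemidef.dotProduct_mulVec_nonneg (v - x)
  rw [Matrix.mulVec_sub, sub_dotProduct, dotProduct_sub, dotProduct_sub, hsymm,
    hdot v hvi hsupp, hdot x hxi hxs] at hnn
  rw [pminor_insert_of_mulVec M hi x hxi hxs hx]
  exact mul_le_mul_of_nonneg_right (by linarith) (pminor_pos hM A).le

theorem IsAcyclic.wellFounded {p : ℕ} {E : Finset (Fin p × Fin p)} (hE : IsAcyclic E) :
    WellFounded (fun a b => (a, b) ∈ E) := by
  have : Std.Irrefl (Relation.TransGen (fun a b : Fin p => (a, b) ∈ E)) := ⟨hE⟩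
  exact Subrelation.wf (fun h => Relation.TransGen.single h)
    (Finite.wellFounded_of_trans_of_irrefl (Relation.TransGen (fun a b : Fin p => (a, b) ∈ E)))

section Inverse

variable {p : ℕ} {E : Finset (Fin p × Fin p)} {L : Matrix (Fin p) (Fin p) ℝ}

theorem IsAcyclic.isUnit_one_sub (hE : IsAcyclic E) (hL : ∀ a b, (a, b) ∉ E → L a b = 0) :
    IsUnit (1 - L) := by
  rw [← Matrix.vecMul_injective_iff_isUnit, ← Matrix.coe_vecMulLinear,
    injective_iff_map_eq_zero]
  intro x hx
  have hx' : x = x ᵥ* L := by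
    rw [Matrix.vecMulLinear_apply, Matrix.vecMul_sub, Matrix.vecMul_one, sub_eq_zero] at hx
    exact hx
  funext j
  induction j using hE.wellFounded.induction with
  | _ j ih =>
    rw [hx', Matrix.vecMul, dotProduct]
    refine Finset.sum_eq_zero fun k _ => ?_
    by_cases hk : (k, j) ∈ E
    · rw [ih k hk, Pi.zero_apply, zero_mul]
    · rw [hL k j hk, mul_zero]

theorem IsAcyclic.inv_apply (hE : IsAcyclic E) (hL : ∀ a b, (a, b) ∉ E → L a b = 0)
    (i j : Fin p) :
    (1 - L)⁻¹ i j = (1 : Matrix (Fin p) (Fin p) ℝ) i j + ∑ k, (1 - L)⁻¹ i k * L k j := by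
  have h := Matrix.nonsing_inv_mul (1 - L)
    ((Matrix.isUnit_iff_isUnit_det _).1 (hE.isUnit_one_sub hL))
  rw [Matrix.mul_sub, Matrix.mul_one, sub_eq_iff_eq_add] at h
  simpa [Matrix.mul_apply] using congrFun (congrFun h i) j

theorem IsAcyclic.inv_apply_eq_zero (hE : IsAcyclic E) (hL : ∀ a b, (a, b) ∉ E → L a b = 0)
    (i j : Fin p) (hj : ¬ InDescClosure E i j) : (1 - L)⁻¹ i j = 0 := by
  induction j using hE.wellFounded.induction with
  | _ j ih =>
    rw [hE.inv_apply hL, Matrix.one_apply_ne (fun h => hj (Or.inl h.symm)), zero_add]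
    refine Finset.sum_eq_zero fun k _ => ?_
    by_cases hk : (k, j) ∈ E
    · rw [ih k hk, zero_mul]
      rintro (rfl | h)
      · exact hj (Or.inr (.single hk))
      · exact hj (Or.inr (h.tail hk))
    · rw [hL k j hk, mul_zero]

theorem IsAcyclic.inv_apply_self (hE : IsAcyclic E) (hL : ∀ a b, (a, b) ∉ E → L a b = 0)
    (i : Fin p) : (1 - L)⁻¹ i i = 1 := by
  rw [hE.inv_apply hL, Matrix.one_apply_eq, Finset.sum_eq_zero, add_zero]
  intro k _
  by_cases hk : (k, i) ∈ E
  · rw [hE.inv_apply_eq_zero hL, zero_mul]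
    rintro (rfl | h)
    · exact hE k (.single hk)
    · exact hE i (h.tail hk)
  · rw [hL k i hk, mul_zero]

theorem IsAcyclic.inv_apply_nonneg (hE : IsAcyclic E) (hL : ∀ a b, (a, b) ∉ E → L a b = 0)
    (hnn : ∀ a b, 0 ≤ L a b) (i j : Fin p) : 0 ≤ (1 - L)⁻¹ i j := by
  induction j using hE.wellFounded.induction with
  | _ j ih =>
    rw [hE.inv_apply hL]
    refine add_nonneg ?_ (Finset.sum_nonneg fun k _ => ?_)
    · rw [Matrix.one_apply]
      split_ifs <;> norm_num
    · by_cases hk : (k, j) ∈ E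
      · exact mul_nonneg (ih k hk) (hnn k j)
      · rw [hL k j hk, mul_zero]

theorem IsAcyclic.inv_apply_pos (hE : IsAcyclic E) (hL : ∀ a b, (a, b) ∉ E → L a b = 0)
    (hnn : ∀ a b, 0 ≤ L a b) {i : Fin p}
    (hpos : ∀ a b, InDescClosure E i a → (a, b) ∈ E → 0 < L a b) {j : Fin p}
    (hj : Relation.TransGen (fun a b => (a, b) ∈ E) i j) : 0 < (1 - L)⁻¹ i j := by
  have step : ∀ a b, InDescClosure E i a → (a, b) ∈ E → 0 < (1 - L)⁻¹ i a →
      0 < (1 - L)⁻¹ i b := by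
    intro a b ha hab h
    rw [hE.inv_apply hL]
    refine add_pos_of_nonneg_of_pos ?_ (Finset.sum_pos' (fun k _ => ?_) ⟨a, Finset.mem_univ a, ?_⟩)
    · rw [Matrix.one_apply]
      split_ifs <;> norm_num
    · exact mul_nonneg (hE.inv_apply_nonneg hL hnn i k) (hnn k b)
    · exact mul_pos h (hpos a b ha hab)
  induction hj with
  | single h =>
    exact step i _ (Or.inl rfl) h (by rw [hE.inv_apply_self hL]; exact one_pos)
  | tail hab hbc ih => exact step _ _ (Or.inr hab) hbc ih

theorem IsAcyclic.posDef_phiG (hE : IsAcyclic E) (hL : ∀ a b, (a, b) ∉ E → L a b = 0)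
    {ω : Fin p → ℝ} (hω : ∀ v, 0 < ω v) : (phiG (Matrix.diagonal ω) L).PosDef := by
  have hinj : Function.Injective ((1 - L)⁻¹).mulVec := by
    rw [Matrix.mulVec_injective_iff_isUnit, Matrix.isUnit_nonsing_inv_iff]
    exact hE.isUnit_one_sub hL
  simpa [phiG] using (Matrix.PosDef.diagonal hω).conjTranspose_mul_mul_same hinj

end Inverse

theorem phiG_diagonal_apply {p : ℕ} (ω : Fin p → ℝ) (L : Matrix (Fin p) (Fin p) ℝ)
    (a b : Fin p) :
    phiG (Matrix.diagonal ω) L a b = ∑ k, ω k * ((1 - L)⁻¹ k a * (1 - L)⁻¹ k b) := by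
  rw [phiG, Matrix.mul_apply]
  refine Finset.sum_congr rfl fun k _ => ?_
  rw [Matrix.mul_diagonal, Matrix.transpose_apply]
  ring

theorem pminor_div_of_parents_subset {p : ℕ} {E : Finset (Fin p × Fin p)} (hE : IsAcyclic E)
    {i : Fin p} {A : Finset (Fin p)} (hpa : parents E i ⊆ A)
    (hde : ∀ j ∈ A, ¬ InDescClosure E i j) {ω : Fin p → ℝ} {L : Matrix (Fin p) (Fin p) ℝ}
    (hω : ∀ v, 0 < ω v) (hL : ∀ a b, (a, b) ∉ E → L a b = 0) :
    pminor (phiG (Matrix.diagonal ω) L) (insert i A) /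
      pminor (phiG (Matrix.diagonal ω) L) A = ω i := by
  have hi : i ∉ A := fun h => hde i h (Or.inl rfl)
  have hii : L i i = 0 := hL i i fun h => hE i (.single h)
  have hMx : ∀ j, (phiG (Matrix.diagonal ω) L *ᵥ ((1 - L) *ᵥ Pi.single i 1)) j =
      ω i * (1 - L)⁻¹ i j := by
    intro j
    rw [Matrix.mulVec_mulVec, phiG, Matrix.mul_assoc, Matrix.nonsing_inv_mul _
      ((Matrix.isUnit_iff_isUnit_det _).1 (hE.isUnit_one_sub hL)), Matrix.mul_one,
      Matrix.mulVec_single_one, Matrix.col_apply, Matrix.mul_diagonal, Matrix.transpose_apply,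
      mul_comm]
  rw [div_eq_iff (pminor_pos (hE.posDef_phiG hL hω) A).ne',
    pminor_insert_of_mulVec _ hi ((1 - L) *ᵥ Pi.single i 1), hMx, hE.inv_apply_self hL, mul_one]
  · simp [hii]
  · intro k hk
    simp only [Finset.mem_insert, not_or] at hk
    have hki : (k, i) ∉ E := fun h => hk.2 (hpa (by simpa [parents] using h))
    simp [hL k i hki, Matrix.one_apply_ne hk.1]
  · intro j hj
    rw [hMx, hE.inv_apply_eq_zero hL i j (hde j hj), mul_zero]

/-- With a descendant of `i` in `A`, conditioning strictly reduces the variance for some `Λ`. -/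
theorem exists_pminor_div_lt_one {p : ℕ} {E : Finset (Fin p × Fin p)} (hE : IsAcyclic E)
    {i j : Fin p} {A : Finset (Fin p)} (hi : i ∉ A) (hjA : j ∈ A)
    (hj : Relation.TransGen (fun a b => (a, b) ∈ E) i j) :
    ∃ L : Matrix (Fin p) (Fin p) ℝ, (∀ a b, (a, b) ∉ E → L a b = 0) ∧
      pminor (phiG (Matrix.diagonal 1) L) (insert i A) /
        pminor (phiG (Matrix.diagonal 1) L) A < 1 := by
  classical
  let L : Matrix (Fin p) (Fin p) ℝ :=
    Matrix.of fun a b => if InDescClosure E i a ∧ (a, b) ∈ E then 1 else 0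
  have hL : ∀ a b, (a, b) ∉ E → L a b = 0 := fun a b h => by simp [L, h]
  have hnn : ∀ a b, 0 ≤ L a b := fun a b => by
    simp only [L, Matrix.of_apply]
    split_ifs <;> norm_num
  have hpos : ∀ a b, InDescClosure E i a → (a, b) ∈ E → 0 < L a b := fun a b h h' => by
    simp [L, h, h']
  have hLi : ∀ k, L k i = 0 := fun k => by
    simp only [L, Matrix.of_apply, ite_eq_right_iff, and_imp]
    rintro (rfl | h) h'
    · exact absurd (.single h') (hE k)
    · exact absurd (h.tail h') (hE i)
  have hcol : ∀ k, (1 - L)⁻¹ k i = (1 : Matrix (Fin p) (Fin p) ℝ) k i := fun k => by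
    rw [hE.inv_apply hL]
    simp [hLi]
  have hrow : ∀ b, phiG (Matrix.diagonal 1) L i b = (1 - L)⁻¹ i b := fun b => by
    rw [phiG_diagonal_apply]
    simp [hcol, Matrix.one_apply]
  have hM : (phiG (Matrix.diagonal 1) L).PosDef := hE.posDef_phiG hL fun _ => one_pos
  refine ⟨L, hL, ?_⟩
  have hB := hE.inv_apply_pos hL hnn hpos hj
  set M := phiG (Matrix.diagonal 1) L with hMdef
  have hjj : 0 < M j j := hM.diag_pos
  have hii : M i i = 1 := by rw [hrow, hE.inv_apply_self hL]
  have hij : 0 < M i j := by rwa [hrow]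
  have hji : M j i = M i j := by simpa using hM.isHermitian.apply i j
  have hne : i ≠ j := fun h => hi (h ▸ hjA)
  rw [div_lt_one (pminor_pos hM A)]
  let t : ℝ := M i j / M j j
  let v : Fin p → ℝ := Pi.single i 1 - t • Pi.single j 1
  have hle := pminor_insert_le hM hi v (by simp [v, hne]) (fun k hk => by
    simp only [Finset.mem_insert, not_or] at hk
    have hkj : k ≠ j := fun h => hk.2 (h ▸ hjA)
    simp [v, hk.1, hkj])
  have hval : v ⬝ᵥ M *ᵥ v = 1 - t * M i j := by
    have ht : t * M j j = M i j := div_mul_cancel₀ _ hjj.ne'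
    simp only [v, Matrix.mulVec_sub, Matrix.mulVec_smul, Matrix.mulVec_single_one,
      sub_dotProduct, dotProduct_sub, smul_dotProduct, dotProduct_smul, single_one_dotProduct,
      Matrix.col_apply, smul_eq_mul, hii, hji]
    rw [ht]
    ring
  refine hle.trans_lt (mul_lt_of_lt_one_left (pminor_pos hM A) ?_)
  rw [hval]
  have : 0 < t * M i j := mul_pos (div_pos hij hjj) hij
  linarith

/-- With a parent of `i` outside `A`, the conditional variance of `i` is too large for some `Λ`. -/
theorem exists_pminor_div_eq_two {p : ℕ} {E : Finset (Fin p × Fin p)} (hE : IsAcyclic E)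
    {i k : Fin p} {A : Finset (Fin p)} (hi : i ∉ A) (hkA : k ∉ A) (hk : (k, i) ∈ E) :
    ∃ L : Matrix (Fin p) (Fin p) ℝ, (∀ a b, (a, b) ∉ E → L a b = 0) ∧
      pminor (phiG (Matrix.diagonal 1) L) (insert i A) /
        pminor (phiG (Matrix.diagonal 1) L) A = 2 := by
  have hki : k ≠ i := fun h => hE i (.single (h ▸ hk))
  have hL : ∀ a b, (a, b) ∉ E → Matrix.single k i (1 : ℝ) a b = 0 := fun a b h => by
    rw [Matrix.single_apply, if_neg]
    rintro ⟨rfl, rfl⟩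
    exact h hk
  have hinv : (1 - Matrix.single k i (1 : ℝ))⁻¹ = 1 + Matrix.single k i 1 := by
    apply Matrix.inv_eq_right_inv
    rw [sub_mul, one_mul, mul_add, mul_one, Matrix.single_mul_single_of_ne _ _ _ _ hki.symm]
    simp
  have hM := hE.posDef_phiG hL (ω := 1) fun _ => one_pos
  have hcol : ∀ j, (phiG (Matrix.diagonal 1) (Matrix.single k i (1 : ℝ)) *ᵥ Pi.single i 1) j =
      (if j = i then 2 else 0) + if j = k then 1 else 0 := by
    intro j
    rw [Matrix.mulVec_single_one, Matrix.col_apply, phiG_diagonal_apply, hinv]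
    by_cases hji : j = i <;> by_cases hjk : j = k <;>
      simp_all [Matrix.one_apply, Matrix.single_apply, mul_add, Finset.sum_add_distrib,
        eq_comm, one_add_one_eq_two]
  refine ⟨_, hL, ?_⟩
  rw [div_eq_iff (pminor_pos hM A).ne',
    pminor_insert_of_mulVec _ hi (Pi.single i 1), hcol, if_pos rfl, if_neg hki.symm, add_zero]
  · simp
  · intro a ha
    simp only [Finset.mem_insert, not_or] at ha
    simp [ha.1]
  · intro j hj
    rw [hcol, if_neg (ne_of_mem_of_not_mem hj hi), if_neg (ne_of_mem_of_not_mem hj hkA),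
      add_zero]

/-- Characterization of vertex-identifying sets.
Let `G = (V,E)` be a DAG, `i ∈ V` and `A ⊆ V`.  Then
`ω_{i|A}(φ_G(Ω,Λ)) = ω_i` for every `Ω = diag(ω)` with positive diagonal and every
`Λ ∈ ℝ^E` if and only if `pa_G(i) ⊆ A` and `A ∩ de̅_G(i) = ∅`. -/
theorem vertex_identifying_iff {p : ℕ} (E : Finset (Fin p × Fin p)) (hE : IsAcyclic E)
    (i : Fin p) (A : Finset (Fin p)) :
    (∀ (ω : Fin p → ℝ) (L : Matrix (Fin p) (Fin p) ℝ),
        (∀ v, 0 < ω v) → (∀ a b, (a, b) ∉ E → L a b = 0) →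
        pminor (phiG (Matrix.diagonal ω) L) (insert i A) /
          pminor (phiG (Matrix.diagonal ω) L) A = ω i)
    ↔ (parents E i ⊆ A ∧ ∀ j ∈ A, ¬ InDescClosure E i j) := by
  refine ⟨fun h => ?_, fun ⟨hpa, hde⟩ ω L hω hL =>
    pminor_div_of_parents_subset hE hpa hde hω hL⟩
  have hi : i ∉ A := by
    intro hi
    have h0 : ∀ a b, (a, b) ∉ E → (0 : Matrix (Fin p) (Fin p) ℝ) a b = 0 := fun _ _ _ => rfl
    have h2 : ∀ _ : Fin p, (0 : ℝ) < 2 := fun _ => two_pos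
    have := h (fun _ => 2) 0 h2 h0
    rw [Finset.insert_eq_of_mem hi, div_self (pminor_pos (hE.posDef_phiG h0 h2) A).ne'] at this
    norm_num at this
  constructor
  · intro k hk
    by_contra hkA
    obtain ⟨L, hL, hL2⟩ := exists_pminor_div_eq_two hE hi hkA (by simpa [parents] using hk)
    have := h 1 L (fun _ => one_pos) hL
    rw [hL2] at this
    norm_num at this
  · rintro j hjA (rfl | hj)
    · exact hi hjA
    · obtain ⟨L, hL, hlt⟩ := exists_pminor_div_lt_one hE hi hjA hj
      exact hlt.ne (h 1 L (fun _ => one_pos) hL)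
end

section
/- Let (G,c) be an edge-colored DAG on vertex set V in which all edges have the same color (a constant edge coloring) and G contains at least two edges. If (H,c') is any edge-colored DAG on V whose edges all have the same color and M(G,c) = M(H,c'), then H = G (the edge sets coincide). That is, (G,c) is structurally identifiable within the class of edge-colored DAGs having exactly one edge color class. -/
open Matrix

/-- The edge-colored Gaussian DAG model of a DAG with constant edge coloring: all edges
share a single structural coefficient, i.e. `Λ = λ·A_G` for a scalar `λ`, while the
error variances are free positive parameters. -/
noncomputable def constEcModel {p : ℕ} (E : Finset (Fin p × Fin p)) :
    Set (Matrix (Fin p) (Fin p) ℝ) :=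
  {S | ∃ (ω : Fin p → ℝ) (lam : ℝ), (∀ v, 0 < ω v) ∧
    S = phiG (Matrix.diagonal ω) (Matrix.of fun a b => if (a, b) ∈ E then lam else 0)}

open Filter Topology

/-- The real adjacency matrix of the directed graph with edge set `E`. -/
def adjMat {p : ℕ} (E : Finset (Fin p × Fin p)) : Matrix (Fin p) (Fin p) ℝ :=
  Matrix.of fun a b => if (a, b) ∈ E then 1 else 0

section Acyclic

variable {p : ℕ} {E : Finset (Fin p × Fin p)}

lemma adjMat_of_mem {i j : Fin p} (h : (i, j) ∈ E) : adjMat E i j = 1 := by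
  simp [adjMat, h]

lemma adjMat_of_notMem {i j : Fin p} (h : (i, j) ∉ E) : adjMat E i j = 0 := by
  simp [adjMat, h]

lemma adjMat_nonneg (i j : Fin p) : 0 ≤ adjMat E i j := by
  simp only [adjMat, Matrix.of_apply]
  split_ifs <;> norm_num

lemma IsAcyclic.notMem_self (hE : IsAcyclic E) (i : Fin p) : (i, i) ∉ E :=
  fun h => hE i (.single h)

lemma IsAcyclic.notMem_swap (hE : IsAcyclic E) {i j : Fin p} (h : (i, j) ∈ E) : (j, i) ∉ E :=
  fun h' => hE i (.tail (.single h) h')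

lemma IsAcyclic.ne (hE : IsAcyclic E) {i j : Fin p} (h : (i, j) ∈ E) : i ≠ j := by
  rintro rfl
  exact hE.notMem_self i h

lemma IsAcyclic.exists_rank (hE : IsAcyclic E) :
    ∃ b : Fin p → ℕ, ∀ i j, (i, j) ∈ E → b i < b j := by
  classical
  refine ⟨fun j => (Finset.univ.filter
    fun k => Relation.TransGen (fun a b => (a, b) ∈ E) k j).card, fun i j hij => ?_⟩
  refine Finset.card_lt_card (Finset.ssubset_iff_of_subset ?_ |>.2 ⟨i, ?_, ?_⟩)
  · intro k hk
    simp only [Finset.mem_filter, Finset.mem_univ, true_and] at hk ⊢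
    exact hk.tail hij
  · simpa using Relation.TransGen.single hij
  · simpa using hE i

lemma IsAcyclic.det_one_sub (hE : IsAcyclic E) (lam : ℝ) :
    (1 - lam • adjMat E).det = 1 := by
  obtain ⟨b, hb⟩ := hE.exists_rank
  have hzero : ∀ i j, b j ≤ b i → adjMat E i j = 0 := fun i j h =>
    adjMat_of_notMem fun hij => (hb i j hij).not_ge h
  have htri : (1 - lam • adjMat E).BlockTriangular b := by
    intro i j hij
    have hne : i ≠ j := by rintro rfl; exact lt_irrefl _ hij
    simp [hzero i j hij.le, Matrix.one_apply_ne hne]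
  rw [htri.det]
  refine Finset.prod_eq_one fun a _ => ?_
  have hblock : (1 - lam • adjMat E).toSquareBlock b a = 1 := by
    ext ⟨i, hi⟩ ⟨j, hj⟩
    simp [Matrix.toSquareBlock_def, hzero i j (by rw [hi, hj]), Matrix.one_apply]
  rw [hblock, Matrix.det_one]

end Acyclic

section Precision

variable {p : ℕ}

/-- The concentration matrix `(1 - λA) D (1 - λA)ᵀ` of the constant edge coloring model. -/
noncomputable def precision (E : Finset (Fin p × Fin p)) (d : Fin p → ℝ) (lam : ℝ) :
    Matrix (Fin p) (Fin p) ℝ :=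
  (1 - lam • adjMat E) * Matrix.diagonal d * (1 - lam • adjMat E)ᵀ

lemma edge_matrix_eq_smul (E : Finset (Fin p × Fin p)) (lam : ℝ) :
    (Matrix.of fun a b => if (a, b) ∈ E then lam else 0) = lam • adjMat E := by
  ext a b
  simp [adjMat]

lemma inv_phiG {E : Finset (Fin p × Fin p)} (hE : IsAcyclic E) {w : Fin p → ℝ}
    (hw : ∀ v, 0 < w v) (lam : ℝ) :
    (phiG (Matrix.diagonal w) (lam • adjMat E))⁻¹ = precision E (fun v => (w v)⁻¹) lam := by
  have hdet : IsUnit (1 - lam • adjMat E).det := by simp [hE.det_one_sub lam]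
  have hdiag : (Matrix.diagonal w)⁻¹ = Matrix.diagonal fun v => (w v)⁻¹ := by
    refine Matrix.inv_eq_right_inv ?_
    rw [Matrix.diagonal_mul_diagonal, ← Matrix.diagonal_one]
    congr 1
    funext v
    exact mul_inv_cancel₀ (hw v).ne'
  rw [phiG, precision, Matrix.mul_inv_rev, Matrix.mul_inv_rev,
    Matrix.nonsing_inv_nonsing_inv _ hdet, ← Matrix.transpose_nonsing_inv,
    Matrix.nonsing_inv_nonsing_inv _ hdet, hdiag, Matrix.mul_assoc]

lemma det_precision {E : Finset (Fin p × Fin p)} (hE : IsAcyclic E) (d : Fin p → ℝ) (lam : ℝ) :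
    (precision E d lam).det = ∏ v, d v := by
  simp [precision, Matrix.det_mul, hE.det_one_sub lam, -Matrix.transpose_sub]

lemma precision_apply (E : Finset (Fin p × Fin p)) (d : Fin p → ℝ) (lam : ℝ) (i j : Fin p) :
    precision E d lam i j = (if i = j then d i else 0)
      - lam * (adjMat E i j * d j + adjMat E j i * d i
        - lam * ∑ v, adjMat E i v * adjMat E j v * d v) := by
  have hterm : ∀ v, (1 - lam • adjMat E) i v * d v * (1 - lam • adjMat E) j v
      = (if i = v then (if j = v then d v else 0) else 0)
        - lam * (if j = v then adjMat E i v * d v else 0)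
        - lam * (if i = v then adjMat E j v * d v else 0)
        + lam * (lam * (adjMat E i v * adjMat E j v * d v)) := by
    intro v
    simp only [Matrix.sub_apply, Matrix.one_apply, Matrix.smul_apply, smul_eq_mul]
    split_ifs <;> ring
  rw [precision, Matrix.mul_apply]
  simp only [Matrix.mul_diagonal, Matrix.transpose_apply, hterm, Finset.sum_add_distrib,
    Finset.sum_sub_distrib, ← Finset.mul_sum, Finset.sum_ite_eq, Finset.mem_univ, if_true]
  simp only [eq_comm (a := j)]
  ring

lemma precision_apply_self {E : Finset (Fin p × Fin p)} (hE : IsAcyclic E) (d : Fin p → ℝ)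
    (lam : ℝ) (i : Fin p) :
    precision E d lam i i = d i + lam ^ 2 * ∑ v, adjMat E i v * adjMat E i v * d v := by
  rw [precision_apply, adjMat_of_notMem (hE.notMem_self i), if_pos rfl]
  ring

lemma exists_precision_eq {E F : Finset (Fin p × Fin p)} (hE : IsAcyclic E) (hF : IsAcyclic F)
    (hsub : constEcModel E ⊆ constEcModel F) {d : Fin p → ℝ} (hd : ∀ v, 0 < d v) (lam : ℝ) :
    ∃ (d' : Fin p → ℝ) (mu : ℝ), (∀ v, 0 < d' v) ∧ precision E d lam = precision F d' mu := by
  obtain ⟨w, mu, hw, heq⟩ := hsub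
    ⟨fun v => (d v)⁻¹, lam, fun v => inv_pos.2 (hd v), rfl⟩
  refine ⟨fun v => (w v)⁻¹, mu, fun v => inv_pos.2 (hw v), ?_⟩
  rw [edge_matrix_eq_smul, edge_matrix_eq_smul] at heq
  rw [← inv_phiG hF hw, ← heq, inv_phiG hE fun v => inv_pos.2 (hd v)]
  simp

end Precision

/-- A sequence of positive vectors with constant product, bounded above coordinatewise by a
sequence tending to a vector with the same product, has the same limit. -/
lemma tendsto_of_le_of_prod_eq {ι : Type*} [Fintype ι] [DecidableEq ι] {d : ι → ℝ}
    {x u : ℕ → ι → ℝ} (hd : ∀ i, 0 < d i) (hx : ∀ n i, 0 < x n i)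
    (hxu : ∀ n i, x n i ≤ u n i) (hprod : ∀ n, ∏ i, x n i = ∏ i, d i)
    (hu : ∀ i, Tendsto (fun n => u n i) atTop (𝓝 (d i))) (i : ι) :
    Tendsto (fun n => x n i) atTop (𝓝 (d i)) := by
  have hpos : 0 < ∏ j ∈ Finset.univ.erase i, d j := Finset.prod_pos fun j _ => hd j
  have hlow : Tendsto (fun n => (∏ j, d j) / ∏ j ∈ Finset.univ.erase i, u n j) atTop
      (𝓝 (d i)) := by
    have h := (tendsto_const_nhds (x := ∏ j, d j)).div
      (tendsto_finsetProd (Finset.univ.erase i) fun j _ => hu j) hpos.ne'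
    rwa [← Finset.mul_prod_erase Finset.univ d (Finset.mem_univ i),
      mul_div_cancel_right₀ _ hpos.ne', Finset.mul_prod_erase Finset.univ d (Finset.mem_univ i)]
      at h
  refine tendsto_of_tendsto_of_tendsto_of_le_of_le hlow (hu i) (fun n => ?_) fun n => hxu n i
  have hupos : 0 < ∏ j ∈ Finset.univ.erase i, u n j :=
    Finset.prod_pos fun j _ => (hx n j).trans_le (hxu n j)
  rw [div_le_iff₀ hupos, ← hprod n, ← Finset.mul_prod_erase Finset.univ (x n) (Finset.mem_univ i)]
  exact mul_le_mul_of_nonneg_left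
    (Finset.prod_le_prod (fun j _ => (hx n j).le) fun j _ => hxu n j) (hx n i).le

/-- First-order comparison of the two models at a positive diagonal concentration matrix. -/
lemma exists_first_order_ratio {p : ℕ} {E F : Finset (Fin p × Fin p)} (hE : IsAcyclic E)
    (hF : IsAcyclic F) (hsub : constEcModel E ⊆ constEcModel F) (hne : E.Nonempty)
    {d : Fin p → ℝ} (hd : ∀ v, 0 < d v) :
    ∃ r : ℝ, ∀ i j, i ≠ j → adjMat E i j * d j + adjMat E j i * d i
      = r * (adjMat F i j * d j + adjMat F j i * d i) := by
  set lam : ℕ → ℝ := fun n => 1 / ((n : ℝ) + 1) with hlam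
  have hlam0 : Tendsto lam atTop (𝓝 0) := tendsto_one_div_add_atTop_nhds_zero_nat
  have hlampos : ∀ n, lam n ≠ 0 := fun n => by positivity
  choose x mu hx hK using fun n => exists_precision_eq hE hF hsub hd (lam n)
  have hdiag : ∀ n i, d i + lam n ^ 2 * ∑ v, adjMat E i v * adjMat E i v * d v
      = x n i + mu n ^ 2 * ∑ v, adjMat F i v * adjMat F i v * x n v := fun n i => by
    rw [← precision_apply_self hE, ← precision_apply_self hF, hK n]
  have hu : ∀ i, Tendsto (fun n => d i + lam n ^ 2 * ∑ v, adjMat E i v * adjMat E i v * d v)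
      atTop (𝓝 (d i)) := fun i => by
    simpa using ((hlam0.pow 2).mul_const
      (∑ v, adjMat E i v * adjMat E i v * d v)).const_add (d i)
  have hxlim : ∀ i, Tendsto (fun n => x n i) atTop (𝓝 (d i)) := by
    refine tendsto_of_le_of_prod_eq hd hx (fun n i => ?_) (fun n => ?_) hu
    · rw [hdiag n i]
      exact le_add_of_nonneg_right (mul_nonneg (sq_nonneg _) (Finset.sum_nonneg fun v _ =>
        mul_nonneg (mul_nonneg (adjMat_nonneg i v) (adjMat_nonneg i v)) (hx n v).le))
    · rw [← det_precision hE d (lam n), ← det_precision hF (x n) (mu n), hK n]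
  have hsumlim : ∀ i j, Tendsto (fun n => ∑ v, adjMat F i v * adjMat F j v * x n v) atTop
      (𝓝 (∑ v, adjMat F i v * adjMat F j v * d v)) := fun i j =>
    tendsto_finsetSum _ fun v _ => (hxlim v).const_mul _
  have hoff : ∀ i j, i ≠ j → ∀ n, adjMat E i j * d j + adjMat E j i * d i
        - lam n * ∑ v, adjMat E i v * adjMat E j v * d v
      = mu n / lam n * (adjMat F i j * x n j + adjMat F j i * x n i
        - mu n * ∑ v, adjMat F i v * adjMat F j v * x n v) := fun i j hij n => by
    have h := congrFun (congrFun (hK n) i) j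
    rw [precision_apply, precision_apply, if_neg hij, if_neg hij] at h
    have h0 := hlampos n
    field_simp
    linarith
  have hleft : ∀ i j, Tendsto (fun n => adjMat E i j * d j + adjMat E j i * d i
        - lam n * ∑ v, adjMat E i v * adjMat E j v * d v) atTop
      (𝓝 (adjMat E i j * d j + adjMat E j i * d i)) := fun i j => by
    simpa using (hlam0.mul_const
      (∑ v, adjMat E i v * adjMat E j v * d v)).const_sub
        (adjMat E i j * d j + adjMat E j i * d i)
  rcases F.eq_empty_or_nonempty with rfl | ⟨⟨a, b⟩, hab⟩
  · obtain ⟨⟨i, j⟩, hij⟩ := hne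
    have h := hleft i j
    simp only [hoff i j (hE.ne hij)] at h
    simp only [adjMat_of_mem hij, adjMat_of_notMem (hE.notMem_swap hij)] at h
    have h0 := tendsto_nhds_unique h (by simp [adjMat] : Tendsto _ _ (𝓝 (0 : ℝ)))
    linarith [hd j]
  have hsumpos : 0 < ∑ v, adjMat F a v * adjMat F a v * d v := by
    refine Finset.sum_pos' (fun v _ => mul_nonneg (mul_nonneg (adjMat_nonneg a v)
      (adjMat_nonneg a v)) (hd v).le) ⟨b, Finset.mem_univ b, ?_⟩
    simpa [adjMat_of_mem hab] using hd b
  have hmu : Tendsto mu atTop (𝓝 0) := by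
    have hprod : Tendsto (fun n => mu n ^ 2 * ∑ v, adjMat F a v * adjMat F a v * x n v) atTop
        (𝓝 0) := by
      have h := (hu a).sub (hxlim a)
      rw [sub_self] at h
      refine h.congr fun n => ?_
      rw [hdiag n a]
      ring
    have hsq : Tendsto (fun n => mu n ^ 2) atTop (𝓝 0) := by
      have h := hprod.div (hsumlim a a) hsumpos.ne'
      rw [zero_div] at h
      refine h.congr' ?_
      filter_upwards [(hsumlim a a).eventually_ne hsumpos.ne'] with n hn
      exact mul_div_cancel_right₀ _ hn
    rw [tendsto_zero_iff_abs_tendsto_zero]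
    have h := hsq.sqrt
    simpa [Real.sqrt_sq_eq_abs, Function.comp_def] using h
  have hright : ∀ i j, Tendsto (fun n => adjMat F i j * x n j + adjMat F j i * x n i
        - mu n * ∑ v, adjMat F i v * adjMat F j v * x n v) atTop
      (𝓝 (adjMat F i j * d j + adjMat F j i * d i)) := fun i j => by
    simpa using (((hxlim j).const_mul (adjMat F i j)).add
      ((hxlim i).const_mul (adjMat F j i))).sub (hmu.mul (hsumlim i j))
  have hcab : adjMat F a b * d b + adjMat F b a * d a ≠ 0 := by
    simpa [adjMat_of_mem hab, adjMat_of_notMem (hF.notMem_swap hab)] using (hd b).ne'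
  have hratio : Tendsto (fun n => mu n / lam n) atTop
      (𝓝 ((adjMat E a b * d b + adjMat E b a * d a)
        / (adjMat F a b * d b + adjMat F b a * d a))) := by
    refine ((hleft a b).div (hright a b) hcab).congr' ?_
    filter_upwards [(hright a b).eventually_ne hcab] with n hn
    rw [Pi.div_apply, hoff a b (hF.ne hab) n]
    exact mul_div_cancel_right₀ _ hn
  refine ⟨(adjMat E a b * d b + adjMat E b a * d a) / (adjMat F a b * d b + adjMat F b a * d a),
    fun i j hij => tendsto_nhds_unique (hleft i j) ?_⟩
  exact (hratio.mul (hright i j)).congr fun n => (hoff i j hij n).symm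

/-- Structural identifiability under homogeneous structural
coefficients.  Let `(G,c)` be an edge-colored DAG with constant edge coloring and at
least two edges.  If `(H,c')` is any edge-colored DAG on the same vertex set with
constant edge coloring and `M(G,c) = M(H,c')`, then `H = G`. -/
theorem const_edge_coloring_identifiable {p : ℕ}
    (E F : Finset (Fin p × Fin p)) (hE : IsAcyclic E) (hF : IsAcyclic F)
    (hcard : 2 ≤ E.card)
    (hmodels : constEcModel E = constEcModel F) :
    E = F := by
  have hne : E.Nonempty := Finset.card_pos.1 (by omega)
  have hratio := fun (d : Fin p → ℝ) (hd : ∀ v, 0 < d v) =>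
    exists_first_order_ratio hE hF hmodels.subset hne hd
  have hsub : ∀ i j, (i, j) ∈ E → (i, j) ∈ F := by
    intro i j hij
    by_contra hijF
    obtain ⟨⟨k, l⟩, hkl, hne'⟩ := Finset.exists_mem_ne (by omega : 1 < E.card) (i, j)
    have hij' := hE.ne hij
    have hkl' := hE.ne hkl
    have hswap : ¬ (k = j ∧ l = i) := by
      rintro ⟨rfl, rfl⟩
      exact hE.notMem_swap hij hkl
    have hsame : ¬ (k = i ∧ l = j) := by
      rintro ⟨rfl, rfl⟩
      exact hne' rfl
    obtain ⟨w, hw, hwi, hwj⟩ : ∃ w, (w = k ∨ w = l) ∧ w ≠ i ∧ w ≠ j := by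
      by_cases h : k ≠ i ∧ k ≠ j
      · exact ⟨k, .inl rfl, h⟩
      · exact ⟨l, .inr rfl, by grind, by grind⟩
    set d : Fin p → ℝ := fun v => if v = j then 2 else if v = w then 5 else 1 with hdef
    have hd : ∀ v, 0 < d v := fun v => by
      simp only [hdef]
      split_ifs <;> norm_num
    obtain ⟨r, hr⟩ := hratio d hd
    have hdi : d i = 1 := by simp [hdef, hij', hwi.symm]
    have hdj : d j = 2 := by simp [hdef]
    have hdw : d w = 5 := by simp [hdef, hwj]
    have hd' : ∀ v, v ≠ w → d v = 1 ∨ d v = 2 := fun v hv => by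
      simp only [hdef, if_neg hv]
      split_ifs <;> simp
    have h1 := hr i j hij'
    rw [adjMat_of_mem hij, adjMat_of_notMem (hE.notMem_swap hij), adjMat_of_notMem hijF,
      hdi, hdj] at h1
    have hr2 : r = 2 := by
      by_cases hjiF : (j, i) ∈ F
      · rw [adjMat_of_mem hjiF] at h1
        linarith
      · rw [adjMat_of_notMem hjiF] at h1
        linarith
    have h2 := hr k l hkl'
    rw [adjMat_of_mem hkl, adjMat_of_notMem (hE.notMem_swap hkl), hr2] at h2
    have hdl := hd l
    by_cases hklF : (k, l) ∈ F
    · rw [adjMat_of_mem hklF, adjMat_of_notMem (hF.notMem_swap hklF)] at h2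
      linarith
    rw [adjMat_of_notMem hklF] at h2
    by_cases hlkF : (l, k) ∈ F
    · rw [adjMat_of_mem hlkF] at h2
      rcases hw with rfl | rfl
      · rcases hd' l hkl'.symm with h | h <;> linarith
      · rcases hd' k hkl' with h | h <;> linarith
    · rw [adjMat_of_notMem hlkF] at h2
      linarith
  refine Finset.Subset.antisymm (fun ⟨i, j⟩ => hsub i j) fun ⟨a, b⟩ hab => ?_
  by_contra habE
  have hbaE : (b, a) ∉ E := fun h => hF.notMem_swap hab (hsub b a h)
  obtain ⟨r, hr⟩ := hratio (fun _ => 1) fun _ => one_pos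
  have h1 := hr a b (hF.ne hab)
  rw [adjMat_of_notMem habE, adjMat_of_notMem hbaE, adjMat_of_mem hab,
    adjMat_of_notMem (hF.notMem_swap hab)] at h1
  obtain ⟨⟨i, j⟩, hij⟩ := hne
  have h2 := hr i j (hE.ne hij)
  rw [adjMat_of_mem hij, adjMat_of_notMem (hE.notMem_swap hij), adjMat_of_mem (hsub i j hij),
    adjMat_of_notMem (hF.notMem_swap (hsub i j hij))] at h2
  linarith
end
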